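/- arXiv:1401.1917 — 3 statements merged into one kernel-verified Lean document; each statement's English description precedes it below -/
import Mathlib

section
/- Let S = {x ∈ ℝⁿ : g₁(x) ≥ 0, …, g_m(x) ≥ 0} and let f = f₀ + Σᵢ fᵢXᵢ be any polynomial of degree at most 1, with homogenization f̃ := f₀X₀ + Σᵢ fᵢXᵢ. Then f(x) ≥ 0 for all x ∈ closure(conv(S)) if and only if f̃(x̃) ≥ 0 for all x̃ ∈ conv(closure(S̃ᵒ)). -/
open MvPolynomial Pointwise

/-- Homogenization of a polynomial in variables `X₁,…,Xₙ` (indexed by `Fin n`, shifted to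
`X₁,…,Xₙ` via `Fin.succ`) with a new homogenizing variable `X₀`. -/
noncomputable def homog {n : ℕ} (f : MvPolynomial (Fin n) ℝ) : MvPolynomial (Fin (n + 1)) ℝ :=
  ∑ α ∈ f.support,
    MvPolynomial.monomial
      (Finsupp.mapDomain Fin.succ α + Finsupp.single 0 (f.totalDegree - α.sum fun _ e => e))
      (MvPolynomial.coeff α f)

/-- The `k`-th truncated quadratic module generated by the family `g`. -/
def QMod {τ ι : Type*} [Fintype ι] (k : ℕ) (g : ι → MvPolynomial τ ℝ) :
    Set (MvPolynomial τ ℝ) :=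
  {p | ∃ s₀ : MvPolynomial τ ℝ, ∃ s : ι → MvPolynomial τ ℝ,
      IsSumSq s₀ ∧ s₀.totalDegree ≤ 2 * k ∧
      (∀ i, IsSumSq (s i) ∧ (s i * g i).totalDegree ≤ 2 * k) ∧
      p = s₀ + ∑ i, s i * g i}

/-- The homogenized generating family `G̃`. -/
noncomputable def tGens {n : ℕ} {ι : Type*} (g : ι → MvPolynomial (Fin n) ℝ) :
    ι ⊕ Fin 3 → MvPolynomial (Fin (n + 1)) ℝ :=
  Sum.elim (fun j => homog (g j))
    ![X 0, (∑ i, X i ^ 2) - 1, 1 - ∑ i, X i ^ 2]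

/-- The modified theta body `TH̃ₖ(G̃)`. -/
noncomputable def thetaB {n : ℕ} {ι : Type*} [Fintype ι] (k : ℕ)
    (g : ι → MvPolynomial (Fin n) ℝ) : Set (Fin n → ℝ) :=
  {x | ∀ l ∈ QMod k (tGens g), l.IsHomogeneous 1 → 0 ≤ eval (Fin.cons 1 x) l}

/-- The Riesz functional of a truncated moment sequence. -/
noncomputable def riesz {m : ℕ} (y : (Fin m →₀ ℕ) → ℝ) (p : MvPolynomial (Fin m) ℝ) : ℝ :=
  ∑ α ∈ p.support, MvPolynomial.coeff α p * y α

/-- The moment relaxation `Ωₖ(G̃)`. -/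
noncomputable def omegaRel {n : ℕ} {ι : Type*} [Fintype ι] (k : ℕ)
    (g : ι → MvPolynomial (Fin n) ℝ) : Set (Fin n → ℝ) :=
  {x | ∃ y : (Fin (n + 1) →₀ ℕ) → ℝ,
      riesz y (X 0) = 1 ∧
      (∀ i : Fin n, riesz y (X i.succ) = x i) ∧
      (∀ q : MvPolynomial (Fin (n + 1)) ℝ, q.totalDegree ≤ k → 0 ≤ riesz y (q ^ 2)) ∧
      (∀ q : MvPolynomial (Fin (n + 1)) ℝ, q.totalDegree ≤ k - 1 → 0 ≤ riesz y (X 0 * q ^ 2)) ∧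
      (∀ q : MvPolynomial (Fin (n + 1)) ℝ, q.totalDegree ≤ 2 * (k - 1) →
        riesz y (((∑ i, X i ^ 2) - 1) * q) = 0) ∧
      (∀ j : ι, ∀ q : MvPolynomial (Fin (n + 1)) ℝ,
        q.totalDegree ≤ k - ((g j).totalDegree + 1) / 2 → 0 ≤ riesz y (homog (g j) * q ^ 2))}

/-- The basic semialgebraic set defined by the family `g`. -/
def semiS {n : ℕ} {ι : Type*} (g : ι → MvPolynomial (Fin n) ℝ) : Set (Fin n → ℝ) :=
  {x | ∀ j, 0 ≤ eval x (g j)}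

/-- `S̃ᵒ`. -/
noncomputable def StO {n : ℕ} {ι : Type*} (g : ι → MvPolynomial (Fin n) ℝ) :
    Set (Fin (n + 1) → ℝ) :=
  {x | (∀ j, 0 ≤ eval x (homog (g j))) ∧ 0 < x 0}

/-- `S̃ᶜ`. -/
noncomputable def StC {n : ℕ} {ι : Type*} (g : ι → MvPolynomial (Fin n) ℝ) :
    Set (Fin (n + 1) → ℝ) :=
  {x | (∀ j, 0 ≤ eval x (homog (g j))) ∧ 0 ≤ x 0}

/-- `S̃ = S̃ᶜ ∩ {‖x̃‖₂ = 1}`. -/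
noncomputable def StS {n : ℕ} {ι : Type*} (g : ι → MvPolynomial (Fin n) ℝ) :
    Set (Fin (n + 1) → ℝ) :=
  {x | (∀ j, 0 ≤ eval x (homog (g j))) ∧ 0 ≤ x 0 ∧ ∑ i, x i ^ 2 = 1}

/-- Assumption A: `S` is closed at infinity, and `conv(closure(S̃ᵒ))` is closed and pointed. -/
noncomputable def AssumpA {n : ℕ} {ι : Type*} (g : ι → MvPolynomial (Fin n) ℝ) : Prop :=
  closure (StO g) = StC g ∧ IsClosed (convexHull ℝ (closure (StO g))) ∧
    convexHull ℝ (closure (StO g)) ∩ -(convexHull ℝ (closure (StO g))) = {0}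

/-- The PP-BDR property with order `k` for the set `T ⊆ ℝⁿ⁺¹` relative to the homogenized
generating family `tGens g`: outside a Lebesgue-null set of coefficient vectors, every affine
polynomial positive on `T` lies in the `k`-th truncated quadratic module of `G̃`. -/
noncomputable def ppBDR {n : ℕ} {ι : Type*} [Fintype ι] (k : ℕ)
    (g : ι → MvPolynomial (Fin n) ℝ) (T : Set (Fin (n + 1) → ℝ)) : Prop :=
  MeasureTheory.volume {c : Fin (n + 2) → ℝ |
    (∀ x ∈ T, 0 < c 0 + ∑ i : Fin (n + 1), c i.succ * x i) ∧
    (C (c 0) + ∑ i : Fin (n + 1), C (c i.succ) * X i) ∉ QMod k (tGens g)} = 0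


theorem eval_homog_aux {n : ℕ} (p : MvPolynomial (Fin n) ℝ) (x : Fin (n + 1) → ℝ)
    (hx : x 0 ≠ 0) :
    eval x (homog p) = x 0 ^ p.totalDegree * eval (fun i : Fin n => x i.succ / x 0) p := by
  rw [homog, map_sum, MvPolynomial.eval_eq, Finset.mul_sum]
  refine Finset.sum_congr rfl fun α hα => ?_
  have hdeg : (α.sum fun _ e => e) ≤ p.totalDegree := MvPolynomial.le_totalDegree hα
  have hsum : (α.sum fun _ e => e) = ∑ i ∈ α.support, α i := rfl
  rw [MvPolynomial.eval_monomial, Finsupp.prod_add_index' (by simp) (by intros; rw [pow_add]),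
    Finsupp.prod_mapDomain_index (by simp) (by intros; rw [pow_add]),
    Finsupp.prod_single_index (by simp)]
  simp only [div_pow, Finset.prod_div_distrib, Finset.prod_pow_eq_pow_sum, Finsupp.prod]
  rw [← hsum]
  have h2 : x 0 ^ p.totalDegree
      = x 0 ^ (p.totalDegree - α.sum fun _ e => e) * x 0 ^ (α.sum fun _ e => e) := by
    rw [← pow_add, Nat.sub_add_cancel hdeg]
  rw [h2]
  have h3 : x 0 ^ (α.sum fun _ e => e) ≠ 0 := pow_ne_zero _ hx
  field_simp

theorem stmt5 (n m : ℕ) (g : Fin m → MvPolynomial (Fin n) ℝ) (f0 : ℝ) (fc : Fin n → ℝ) :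
    (∀ x ∈ closure (convexHull ℝ (semiS g)), 0 ≤ f0 + ∑ i : Fin n, fc i * x i) ↔
      (∀ x ∈ convexHull ℝ (closure (StO g)),
        0 ≤ f0 * x 0 + ∑ i : Fin n, fc i * x i.succ) := by
  constructor
  · intro h
    have hconv : Convex ℝ {x : Fin (n + 1) → ℝ | 0 ≤ f0 * x 0 + ∑ i : Fin n, fc i * x i.succ} := by
      refine convex_halfSpace_ge ⟨fun x y => ?_, fun c x => ?_⟩ 0
      · simp only [Pi.add_apply, mul_add, Finset.sum_add_distrib]; ring
      · simp only [Pi.smul_apply, smul_eq_mul, mul_add, Finset.mul_sum]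
        congr 1
        · ring
        · exact Finset.sum_congr rfl fun i _ => by ring
    have hclosed : IsClosed
        {x : Fin (n + 1) → ℝ | 0 ≤ f0 * x 0 + ∑ i : Fin n, fc i * x i.succ} :=
      isClosed_le continuous_const (by fun_prop)
    refine fun x hx => convexHull_min (closure_minimal ?_ hclosed) hconv hx
    rintro y ⟨hy, hy0⟩
    have hm : (fun i : Fin n => y i.succ / y 0) ∈ semiS g := by
      intro j
      have := hy j
      rw [eval_homog_aux _ _ hy0.ne'] at this
      exact nonneg_of_mul_nonneg_right this (pow_pos hy0 _)
    have h1 := mul_nonneg hy0.le (h _ (subset_closure (subset_convexHull ℝ _ hm)))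
    rw [mul_add, Finset.mul_sum] at h1
    have h2 : ∑ i : Fin n, y 0 * (fc i * (y i.succ / y 0)) = ∑ i : Fin n, fc i * y i.succ :=
      Finset.sum_congr rfl fun i _ => by field_simp
    rw [h2] at h1
    show 0 ≤ f0 * y 0 + ∑ i : Fin n, fc i * y i.succ
    linarith
  · intro h
    have hconv : Convex ℝ {x : Fin n → ℝ | 0 ≤ f0 + ∑ i : Fin n, fc i * x i} := by
      have h0 : Convex ℝ {x : Fin n → ℝ | -f0 ≤ ∑ i : Fin n, fc i * x i} := by
        refine convex_halfSpace_ge ⟨fun x y => ?_, fun c x => ?_⟩ _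
        · simp only [Pi.add_apply, mul_add, Finset.sum_add_distrib]
        · simp only [Pi.smul_apply, smul_eq_mul, Finset.mul_sum]
          exact Finset.sum_congr rfl fun i _ => by ring
      convert h0 using 3
      constructor <;> intro <;> linarith
    have hclosed : IsClosed {x : Fin n → ℝ | 0 ≤ f0 + ∑ i : Fin n, fc i * x i} :=
      isClosed_le continuous_const (by fun_prop)
    refine fun x hx => closure_minimal (convexHull_min ?_ hconv) hclosed hx
    intro y hy
    have hm : (Fin.cons 1 y : Fin (n + 1) → ℝ) ∈ StO g := by
      refine ⟨fun j => ?_, by simp⟩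
      rw [eval_homog_aux _ _ (by simp)]
      simpa using hy j
    simpa using h _ (subset_convexHull ℝ _ (subset_closure hm))
end

section
/- Let S = {x ∈ ℝⁿ : g₁(x) ≥ 0, …, g_m(x) ≥ 0} and suppose Assumption A holds. Then closure(conv(S)) ⊆ TH̃_k(G̃) for every k ∈ ℕ, and closure(conv(S)) = ⋂_{k=1}^∞ TH̃_k(G̃). -/
open MvPolynomial Pointwise

section PutinarAbstract

/-- Archimedean quadratic module in a commutative real algebra. -/
structure ArchQM {A : Type*} [CommRing A] [Algebra ℝ A] (M : Set A) : Prop where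
  sq : ∀ a, a * a ∈ M
  add : ∀ a ∈ M, ∀ b ∈ M, a + b ∈ M
  mul_sq : ∀ a, ∀ m ∈ M, a * a * m ∈ M
  arch : ∀ a, ∃ N : ℝ, N • (1 : A) - a ∈ M

variable {A : Type*} [CommRing A] [Algebra ℝ A] {M : Set A}

theorem ArchQM.smul (h : ArchQM M) {r : ℝ} (hr : 0 ≤ r) {m : A} (hm : m ∈ M) : r • m ∈ M := by
  have := h.mul_sq (algebraMap ℝ A (Real.sqrt r)) m hm
  rwa [← map_mul, Real.mul_self_sqrt hr, ← Algebra.smul_def] at this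

theorem ArchQM.zero (h : ArchQM M) : (0 : A) ∈ M := by simpa using h.sq 0

theorem ArchQM.one (h : ArchQM M) : (1 : A) ∈ M := by simpa using h.sq 1

theorem ArchQM.arch_pos (h : ArchQM M) (a : A) (B : ℝ) : ∃ N : ℝ, B < N ∧ N • (1 : A) - a ∈ M := by
  obtain ⟨N, hN⟩ := h.arch a
  refine ⟨max N B + 1, by linarith [le_max_right N B], ?_⟩
  have h2 := h.add _ hN _ (h.smul (r := max N B + 1 - N) (by linarith [le_max_left N B]) h.one)
  convert h2 using 1
  rw [sub_smul]; abel

/-- If `f ∉ M`, a state nonpositive at `f` exists. -/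
theorem ArchQM.exists_state (h : ArchQM M) {f : A} (hf : f ∉ M) :
    ∃ φ : A →ₗ[ℝ] ℝ, (∀ m ∈ M, 0 ≤ φ m) ∧ φ 1 = 1 ∧ φ f ≤ 0 := by
  have h10 : (1 : A) ≠ 0 := by
    intro h1
    apply hf
    have : f = 0 := by rw [← mul_one f, h1, mul_zero]
    rw [this]; exact h.zero
  let K : PointedCone ℝ A :=
    { carrier := {x | ∃ m ∈ M, ∃ t : ℝ, 0 ≤ t ∧ x = m - t • f}
      add_mem' := by
        rintro _ _ ⟨m, hm, t, ht, rfl⟩ ⟨m', hm', t', ht', rfl⟩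
        exact ⟨m + m', h.add _ hm _ hm', t + t', add_nonneg ht ht', by rw [add_smul]; abel⟩
      zero_mem' := ⟨0, h.zero, 0, le_rfl, by simp⟩
      smul_mem' := by
        rintro ⟨c, hc⟩ _ ⟨m, hm, t, ht, rfl⟩
        refine ⟨c • m, h.smul hc hm, c * t, mul_nonneg hc ht, ?_⟩
        change c • (m - t • f) = _
        rw [smul_sub, smul_smul] }
  have hK : ∀ x, x ∈ K ↔ ∃ m ∈ M, ∃ t : ℝ, 0 ≤ t ∧ x = m - t • f := fun x => Iff.rfl
  let p : A →ₗ.[ℝ] ℝ := LinearPMap.mkSpanSingleton (1 : A) (1 : ℝ) h10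
  have hp : ∀ (c : ℝ) (hc : c • (1 : A) ∈ p.domain), p ⟨c • (1 : A), hc⟩ = c := by
    intro c hc
    have := LinearPMap.mkSpanSingleton'_apply (σ := RingHom.id ℝ) (1 : A) (1 : ℝ)
      (fun c hc => by
        rcases smul_eq_zero.1 hc with h | h
        · simp [h]
        · exact absurd h h10) c hc
    refine Eq.trans this ?_
    simp
  obtain ⟨φ, h1, h2⟩ := riesz_extension K p (by
    rintro ⟨x, hx⟩ hxK
    obtain ⟨c, rfl⟩ := Submodule.mem_span_singleton.1 hx
    rw [hp]
    by_contra hc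
    push Not at hc
    obtain ⟨m, hm, t, ht, hmt⟩ := (hK _).1 hxK
    have hmt' : t • f = m + (-c) • (1 : A) := by
      change c • (1 : A) = _ at hmt
      rw [neg_smul, hmt]; abel
    have hmem : t • f ∈ M := by
      rw [hmt']; exact h.add _ hm _ (h.smul (by linarith) h.one)
    rcases ht.eq_or_lt with rfl | ht
    · apply hf
      obtain ⟨N, hN0, hN⟩ := h.arch_pos (-f) 0
      have hm' : m = c • (1 : A) := by
        rw [zero_smul, neg_smul] at hmt'
        rw [← sub_eq_zero, sub_eq_add_neg]; exact hmt'.symm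
      have := h.add _ hN _ (h.smul (r := N / (-c)) (div_nonneg hN0.le (by linarith)) hm)
      rw [hm', smul_smul, div_mul_eq_mul_div, mul_div_assoc] at this
      have e : c / -c = -1 := by rw [div_neg, div_self hc.ne]
      rw [e] at this
      convert this using 1
      rw [mul_neg, mul_one, neg_smul]; abel
    · apply hf
      have := h.smul (r := t⁻¹) (by positivity) hmem
      rwa [smul_smul, inv_mul_cancel₀ ht.ne', one_smul] at this) (by
    intro y
    obtain ⟨N, hN⟩ := h.arch (-y)
    refine ⟨⟨N • 1, Submodule.mem_span_singleton.2 ⟨N, rfl⟩⟩, ?_⟩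
    exact (hK _).2 ⟨_, hN, 0, le_rfl, by simp⟩)
  refine ⟨φ, fun m hm => h2 m ((hK _).2 ⟨m, hm, 0, le_rfl, by simp⟩), ?_, ?_⟩
  · have hd : (1 : ℝ) • (1 : A) ∈ p.domain := Submodule.mem_span_singleton.2 ⟨1, rfl⟩
    have := h1 ⟨_, hd⟩
    rw [hp] at this
    simpa using this
  · have := h2 (-f) ((hK _).2 ⟨0, h.zero, 1, zero_le_one, by simp⟩)
    rw [map_neg] at this
    linarith

/-- Growth bound for positive functionals. -/
theorem growth_bound (L : A →ₗ[ℝ] ℝ) (hL : ∀ b, 0 ≤ L (b * b)) (a : A) (N C : ℝ) (hN : 0 < N)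
    (hC : ∀ k : ℕ, L (a ^ k * a ^ k) ≤ C * N ^ k) : L (a * a) ≤ N * L 1 := by
  by_contra hlt
  push Not at hlt
  let u : ℕ → ℝ := fun k => L (a ^ k * a ^ k)
  have hu0 : u 0 = L 1 := by simp [u]
  have hu1 : u 1 = L (a * a) := by simp [u]
  have hun : ∀ k, 0 ≤ u k := fun k => hL _
  have hcs : ∀ k, u (k + 1) ^ 2 ≤ u k * u (k + 2) := by
    intro k
    have hq : ∀ t : ℝ, 0 ≤ u k * (t * t) + 2 * u (k + 1) * t + u (k + 2) := by
      intro t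
      have := hL (t • a ^ k + a ^ (k + 2))
      have e : (t • a ^ k + a ^ (k + 2)) * (t • a ^ k + a ^ (k + 2)) =
          (t * t) • (a ^ k * a ^ k) + (2 * t) • (a ^ (k + 1) * a ^ (k + 1)) +
            a ^ (k + 2) * a ^ (k + 2) := by
        simp only [Algebra.smul_def, map_mul, map_ofNat]; ring
      rw [e, map_add, map_add, map_smul, map_smul, smul_eq_mul, smul_eq_mul] at this
      change 0 ≤ t * t * u k + 2 * t * u (k + 1) + u (k + 2) at this
      linarith
    have := discrim_le_zero hq
    unfold discrim at this
    nlinarith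
  have h0 : 0 < u 0 := by
    rcases (hun 0).eq_or_lt with h | h
    · have h2 := hcs 0
      rw [← h, zero_mul] at h2
      have h3 : u 1 = 0 := by simpa using pow_eq_zero_iff (two_ne_zero) |>.1 (le_antisymm h2 (sq_nonneg _))
      rw [← hu1, ← hu0, ← h, h3] at hlt
      simp at hlt
    · exact h
  obtain ⟨r, hr⟩ : ∃ r, r = u 1 / u 0 := ⟨_, rfl⟩
  have hrN : N < r := by
    rw [hr, lt_div_iff₀ h0, hu0, hu1]; exact hlt
  have hstep : ∀ k, 0 < u k ∧ r * u k ≤ u (k + 1) := by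
    intro k
    induction k with
    | zero => exact ⟨h0, by rw [hr, div_mul_cancel₀ _ h0.ne']⟩
    | succ k ih =>
      obtain ⟨hp, hk⟩ := ih
      have hp1 : 0 < u (k + 1) := lt_of_lt_of_le (mul_pos (hN.trans hrN) hp) hk
      refine ⟨hp1, ?_⟩
      have h3 := hcs k
      have h4 : u k * (r * u (k + 1)) ≤ u k * u (k + 2) := by nlinarith
      exact le_of_mul_le_mul_left h4 hp
  have hgeo : ∀ k, r ^ k * u 0 ≤ u k := by
    intro k
    induction k with
    | zero => simp
    | succ k ih =>
      calc r ^ (k + 1) * u 0 = r * (r ^ k * u 0) := by ring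
        _ ≤ r * u k := mul_le_mul_of_nonneg_left ih (hN.trans hrN).le
        _ ≤ _ := (hstep k).2
  have hb : ∀ k : ℕ, (r / N) ^ k ≤ C / u 0 := by
    intro k
    rw [div_pow, div_le_div_iff₀ (by positivity) h0]
    exact (hgeo k).trans (hC k)
  obtain ⟨k, hk⟩ := pow_unbounded_of_one_lt (C / u 0) ((one_lt_div hN).2 hrN)
  exact absurd (hb k) (not_le.2 hk)

theorem ArchQM.sq_bound (h : ArchQM M) (φ : A →ₗ[ℝ] ℝ) (hφ : ∀ m ∈ M, 0 ≤ φ m)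
    (a : A) {N : ℝ} (hN : 0 < N) (ha : N • (1 : A) - a * a ∈ M) (p : A) (hp : p ∈ M) :
    φ (a * a * p) ≤ N * φ p := by
  obtain ⟨C, hC0, hC⟩ := h.arch_pos p 0
  have h1 : 0 ≤ φ 1 := hφ _ h.one
  have hpow : ∀ k : ℕ, φ (a ^ k * a ^ k) ≤ N ^ k * φ 1 := by
    intro k
    induction k with
    | zero => simp
    | succ k ih =>
      have h3 := hφ _ (h.mul_sq (a ^ k) _ ha)
      have e : a ^ k * a ^ k * (N • (1 : A) - a * a) =
          N • (a ^ k * a ^ k) - a ^ (k + 1) * a ^ (k + 1) := by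
        simp only [Algebra.smul_def]; ring
      rw [e, map_sub, map_smul, smul_eq_mul] at h3
      calc φ (a ^ (k + 1) * a ^ (k + 1)) ≤ N * φ (a ^ k * a ^ k) := by linarith
        _ ≤ N * (N ^ k * φ 1) := mul_le_mul_of_nonneg_left ih hN.le
        _ = _ := by ring
  have := growth_bound (φ ∘ₗ LinearMap.mulRight ℝ p) (fun b => hφ _ (h.mul_sq b _ hp)) a N
    (C * φ 1) hN (by
      intro k
      have h3 := hφ _ (h.mul_sq (a ^ k) _ hC)
      have e : a ^ k * a ^ k * (C • (1 : A) - p) = C • (a ^ k * a ^ k) - a ^ k * a ^ k * p := by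
        simp only [Algebra.smul_def]; ring
      rw [e, map_sub, map_smul, smul_eq_mul] at h3
      change φ (a ^ k * a ^ k * p) ≤ _
      calc φ (a ^ k * a ^ k * p) ≤ C * φ (a ^ k * a ^ k) := by linarith
        _ ≤ C * (N ^ k * φ 1) := mul_le_mul_of_nonneg_left (hpow k) hC0.le
        _ = _ := by ring)
  simpa using this

/-- The state space. -/
def stateSp (M : Set A) : Set (A → ℝ) :=
  {φ | (∀ a b, φ (a + b) = φ a + φ b) ∧ (∀ (r : ℝ) a, φ (r • a) = r * φ a) ∧
    (∀ m ∈ M, 0 ≤ φ m) ∧ φ 1 = 1}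

theorem stateSp_of_lin (φ : A →ₗ[ℝ] ℝ) (h1 : ∀ m ∈ M, 0 ≤ φ m) (h2 : φ 1 = 1) :
    (φ : A → ℝ) ∈ stateSp M :=
  ⟨fun a b => map_add _ _ _, fun r a => by simp, h1, h2⟩

theorem stateSp_lin {φ : A → ℝ} (h : φ ∈ stateSp M) :
    ∃ ψ : A →ₗ[ℝ] ℝ, (ψ : A → ℝ) = φ :=
  ⟨{ toFun := φ, map_add' := h.1, map_smul' := by simpa using h.2.1 }, rfl⟩

theorem stateSp_convex : Convex ℝ (stateSp M) := by
  rintro φ ⟨a1, a2, a3, a4⟩ ψ ⟨b1, b2, b3, b4⟩ s t hs ht hst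
  refine ⟨fun a b => ?_, fun r a => ?_, fun m hm => ?_, ?_⟩
  · simp only [Pi.add_apply, Pi.smul_apply, smul_eq_mul, a1, b1]; ring
  · simp only [Pi.add_apply, Pi.smul_apply, smul_eq_mul, a2, b2]; ring
  · have := a3 m hm
    have := b3 m hm
    simp only [Pi.add_apply, Pi.smul_apply, smul_eq_mul]; positivity
  · simp [a4, b4, hst]

theorem ArchQM.stateSp_compact (h : ArchQM M) : IsCompact (stateSp M) := by
  choose N hN using h.arch
  have hcl : IsClosed (stateSp M) := by
    have e : stateSp M = (⋂ a, ⋂ b, {φ : A → ℝ | φ (a + b) = φ a + φ b}) ∩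
        ((⋂ r : ℝ, ⋂ a, {φ : A → ℝ | φ (r • a) = r * φ a}) ∩
        ((⋂ m ∈ M, {φ : A → ℝ | 0 ≤ φ m}) ∩ {φ | φ 1 = 1})) := by
      ext φ; simp [stateSp]
    rw [e]
    refine IsClosed.inter (isClosed_iInter fun a => isClosed_iInter fun b =>
      isClosed_eq (by fun_prop) (by fun_prop)) (IsClosed.inter (isClosed_iInter fun a =>
      isClosed_iInter fun b => isClosed_eq (by fun_prop) (by fun_prop)) (IsClosed.inter
      (isClosed_biInter fun a _ => isClosed_le (by fun_prop) (by fun_prop))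
      (isClosed_eq (by fun_prop) (by fun_prop))))
  refine IsCompact.of_isClosed_subset (isCompact_univ_pi fun a => isCompact_Icc (a := -N (-a))
    (b := N a)) hcl ?_
  intro φ hφ a _
  obtain ⟨ψ, rfl⟩ := stateSp_lin hφ
  have h1 := hφ.2.2.1 _ (hN a)
  have h2 := hφ.2.2.1 _ (hN (-a))
  have h3 := hφ.2.2.2
  simp only [map_sub, map_smul, map_neg, smul_eq_mul, h3] at h1 h2
  constructor <;> linarith

theorem ArchQM.extreme_mul (h : ArchQM M) (φ : A →ₗ[ℝ] ℝ)
    (hφ : (φ : A → ℝ) ∈ (stateSp M).extremePoints ℝ) (a p : A) :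
    φ (a * a * p) = φ (a * a) * φ p := by
  obtain ⟨hs, hext⟩ := mem_extremePoints.1 hφ
  obtain ⟨-, -, hpos, h1⟩ := hs
  obtain ⟨N0, hN00, hN0⟩ := h.arch_pos (a * a) 0
  obtain ⟨N, hNN, hN⟩ : ∃ N, max 0 (φ (a * a)) < N ∧ N • (1 : A) - a * a ∈ M :=
    h.arch_pos _ _
  have hNp : 0 < N := lt_of_le_of_lt (le_max_left _ _) hNN
  have hNa : φ (a * a) < N := lt_of_le_of_lt (le_max_right _ _) hNN
  let φ1 : A →ₗ[ℝ] ℝ := φ ∘ₗ LinearMap.mulLeft ℝ (a * a)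
  have hφ1 : ∀ q, φ1 q = φ (a * a * q) := fun q => rfl
  have hphi_posA : ∀ m ∈ M, 0 ≤ φ1 m := fun m hm => hpos _ (h.mul_sq a m hm)
  have hphi_oneA : φ1 1 = φ (a * a) := by simp [hφ1]
  rcases (hphi_posA 1 h.one).eq_or_lt with h0 | h0
  · obtain ⟨C, hC⟩ := h.arch p
    obtain ⟨C', hC'⟩ := h.arch (-p)
    have e1 := hphi_posA _ hC
    have e2 := hphi_posA _ hC'
    simp only [map_sub, map_smul, map_neg, smul_eq_mul, ← h0] at e1 e2
    rw [← hφ1, ← hphi_oneA, ← h0]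
    linarith
  · let φ2 : A →ₗ[ℝ] ℝ := N • φ - φ1
    have hphi_posB : ∀ m ∈ M, 0 ≤ φ2 m := fun m hm => by
      have := h.sq_bound φ hpos a hNp hN m hm
      simp only [φ2, LinearMap.sub_apply, LinearMap.smul_apply, smul_eq_mul, hφ1]
      linarith
    have hphi_oneB : φ2 1 = N - φ1 1 := by simp [φ2, h1]
    have h20 : 0 < φ2 1 := by rw [hphi_oneB, hphi_oneA]; linarith
    have m1 := stateSp_of_lin (M := M) ((φ1 1)⁻¹ • φ1) (fun m hm => by
      have := hphi_posA m hm
      simp only [LinearMap.smul_apply, smul_eq_mul]; positivity) (by simp [h0.ne'])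
    have m2 := stateSp_of_lin (M := M) ((φ2 1)⁻¹ • φ2) (fun m hm => by
      have := hphi_posB m hm
      simp only [LinearMap.smul_apply, smul_eq_mul]; positivity) (by simp [h20.ne'])
    have := (hext _ m1 _ m2 ⟨φ1 1 / N, φ2 1 / N, by positivity, by positivity, by
      rw [hphi_oneB]; field_simp; ring, by
      ext q
      simp only [Pi.add_apply, Pi.smul_apply, LinearMap.smul_apply, smul_eq_mul]
      have : φ2 q = N * φ q - φ1 q := by simp [φ2]
      field_simp
      linarith⟩).1
    have := congrFun this p
    simp only [LinearMap.smul_apply, smul_eq_mul] at this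
    rw [← hφ1, ← hphi_oneA, ← this]
    field_simp

/-- Abstract Putinar theorem. -/
theorem ArchQM.putinar (h : ArchQM M) (f : A) (δ : ℝ) (hδ : 0 < δ)
    (hf : ∀ φ : A →ₐ[ℝ] ℝ, (∀ m ∈ M, 0 ≤ φ m) → δ ≤ φ f) : f ∈ M := by
  by_contra hfM
  obtain ⟨φ, hφ, hφ1, hφf⟩ := h.exists_state hfM
  have hmem := stateSp_of_lin φ hφ hφ1
  rw [← closure_convexHull_extremePoints h.stateSp_compact stateSp_convex] at hmem
  have hsub : closure (convexHull ℝ ((stateSp M).extremePoints ℝ)) ⊆ {ψ : A → ℝ | δ ≤ ψ f} := by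
    refine closure_minimal (convexHull_min ?_ ?_) (isClosed_le (by fun_prop) (by fun_prop))
    · intro ψ hψ
      obtain ⟨ψ, rfl⟩ := stateSp_lin hψ.1
      have hsq := h.extreme_mul ψ hψ
      have hm : ∀ a b, ψ (a * b) = ψ a * ψ b := by
        intro a b
        have e : a = (1 / 4 : ℝ) • ((a + 1) * (a + 1)) - (1 / 4 : ℝ) • ((a - 1) * (a - 1)) := by
          rw [← smul_sub]
          have : (a + 1) * (a + 1) - (a - 1) * (a - 1) = (4 : ℝ) • a := by
            simp only [Algebra.smul_def, map_ofNat]; ring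
          rw [this, smul_smul]; norm_num
        have e2 : a * b = (1 / 4 : ℝ) • ((a + 1) * (a + 1) * b)
            - (1 / 4 : ℝ) • ((a - 1) * (a - 1) * b) := by
          conv_lhs => rw [e]
          rw [sub_mul, smul_mul_assoc, smul_mul_assoc]
        rw [e2, map_sub, map_smul, map_smul, hsq, hsq]
        conv_rhs => rw [e, map_sub, map_smul, map_smul]
        simp only [smul_eq_mul]; ring
      exact hf (AlgHom.ofLinearMap ψ hψ.1.2.2.2 hm) hψ.1.2.2.1
    · intro x hx y hy s t hs ht hst
      simp only [Set.mem_ofPred_eq, Pi.add_apply, Pi.smul_apply, smul_eq_mul] at *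
      have : δ = s * δ + t * δ := by rw [← add_mul, hst, one_mul]
      rw [this]; gcongr
  have := hsub hmem
  simp only [Set.mem_ofPred_eq] at this
  linarith

end PutinarAbstract

section QModArch

variable {τ ι : Type*} [Fintype ι]

/-- The full (untruncated) quadratic module. -/
def QFull (g : ι → MvPolynomial τ ℝ) : Set (MvPolynomial τ ℝ) :=
  {p | ∃ s₀ : MvPolynomial τ ℝ, ∃ s : ι → MvPolynomial τ ℝ,
      IsSumSq s₀ ∧ (∀ i, IsSumSq (s i)) ∧ p = s₀ + ∑ i, s i * g i}

theorem QFull_QMod (g : ι → MvPolynomial τ ℝ) {p : MvPolynomial τ ℝ} (hp : p ∈ QFull g) :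
    ∃ k, p ∈ QMod (k + 1) g := by
  obtain ⟨s₀, s, h0, hs, rfl⟩ := hp
  refine ⟨s₀.totalDegree + ∑ i, (s i * g i).totalDegree, s₀, s, h0, by omega,
    fun i => ⟨hs i, ?_⟩, rfl⟩
  have := Finset.single_le_sum (f := fun i => (s i * g i).totalDegree) (fun _ _ => Nat.zero_le _)
    (Finset.mem_univ i)
  omega

theorem QMod_eval_nonneg (g : ι → MvPolynomial τ ℝ) {p : MvPolynomial τ ℝ} {k : ℕ}
    (hp : p ∈ QMod k g) (z : τ → ℝ) (hz : ∀ i, 0 ≤ eval z (g i)) : 0 ≤ eval z p := by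
  obtain ⟨s₀, s, h0, -, hs, rfl⟩ := hp
  have key : ∀ q : MvPolynomial τ ℝ, IsSumSq q → 0 ≤ eval z q := by
    intro q hq
    induction hq with
    | zero => simp
    | sq_add a _ ih =>
      rw [map_add, map_mul]; exact add_nonneg (mul_self_nonneg _) ih
  rw [map_add, map_sum]
  refine add_nonneg (key _ h0) (Finset.sum_nonneg fun i _ => ?_)
  rw [map_mul]
  exact mul_nonneg (key _ (hs i).1) (hz i)

theorem QFull_sumSq (g : ι → MvPolynomial τ ℝ) {p : MvPolynomial τ ℝ} (hp : IsSumSq p) :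
    p ∈ QFull g := ⟨p, 0, hp, fun _ => IsSumSq.zero, by simp⟩

theorem QFull_gen (g : ι → MvPolynomial τ ℝ) (i : ι) : g i ∈ QFull g := by
  classical
  refine ⟨0, fun j => if j = i then 1 else 0, IsSumSq.zero, fun j => ?_, by simp⟩
  dsimp only
  split_ifs
  · exact IsSumSq.one
  · exact IsSumSq.zero

theorem QFull_add (g : ι → MvPolynomial τ ℝ) {p q : MvPolynomial τ ℝ} (hp : p ∈ QFull g)
    (hq : q ∈ QFull g) : p + q ∈ QFull g := by
  obtain ⟨s₀, s, h0, hs, rfl⟩ := hp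
  obtain ⟨t₀, t, h0', ht, rfl⟩ := hq
  refine ⟨s₀ + t₀, s + t, h0.add h0', fun i => (hs i).add (ht i), ?_⟩
  simp only [Pi.add_apply, add_mul, Finset.sum_add_distrib]
  ring

theorem QFull_mul (g : ι → MvPolynomial τ ℝ) {p q : MvPolynomial τ ℝ} (hp : IsSumSq p)
    (hq : q ∈ QFull g) : p * q ∈ QFull g := by
  obtain ⟨t₀, t, h0', ht, rfl⟩ := hq
  refine ⟨p * t₀, fun i => p * t i, hp.mul h0', fun i => hp.mul (ht i), ?_⟩
  simp only [mul_add, Finset.mul_sum, mul_assoc]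

theorem isSumSq_C {r : ℝ} (hr : 0 ≤ r) : IsSumSq (C r : MvPolynomial τ ℝ) := by
  rw [← Real.mul_self_sqrt hr, C_mul]
  exact IsSumSq.mul_self _

theorem QFull_arch (g : ι → MvPolynomial τ ℝ)
    (hX : ∀ i : τ, 1 - X i * X i ∈ QFull g) : ArchQM (QFull g) := by
  have hsq : ∀ a : MvPolynomial τ ℝ, ∃ N : ℝ, 0 ≤ N ∧ C N - a * a ∈ QFull g := by
    intro a
    induction a using MvPolynomial.induction_on with
    | C r =>
      refine ⟨r * r, mul_self_nonneg _, ?_⟩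
      rw [C_mul, sub_self]
      exact QFull_sumSq g IsSumSq.zero
    | add p q hp hq =>
      obtain ⟨N, hN0, hN⟩ := hp
      obtain ⟨N', hN0', hN'⟩ := hq
      refine ⟨2 * (N + N'), by positivity, ?_⟩
      have := QFull_add g (QFull_mul g (isSumSq_C (zero_le_two)) (QFull_add g hN hN'))
        (QFull_sumSq g (IsSumSq.mul_self (p - q)))
      convert this using 1
      simp only [C_mul, C_add, map_ofNat]
      ring
    | mul_X p i hp =>
      obtain ⟨N, hN0, hN⟩ := hp
      refine ⟨N, hN0, ?_⟩
      have := QFull_add g (QFull_mul g (IsSumSq.mul_self (X i)) hN)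
        (QFull_mul g (isSumSq_C hN0) (hX i))
      convert this using 1
      ring
  refine ⟨fun a => QFull_sumSq g (IsSumSq.mul_self a), fun a ha b hb => QFull_add g ha hb,
    fun a m hm => QFull_mul g (IsSumSq.mul_self a) hm, fun a => ?_⟩
  obtain ⟨N, hN0, hN⟩ := hsq a
  refine ⟨N + 1 / 4, ?_⟩
  have := QFull_add g hN (QFull_sumSq g (IsSumSq.mul_self (a - C (1 / 2))))
  convert this using 1
  rw [smul_eq_C_mul, mul_one]
  have e1 : (C (1 / 2) : MvPolynomial τ ℝ) * C (1 / 2) = C (1 / 4) := by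
    rw [← C_mul]; norm_num
  have e2 : (2 : MvPolynomial τ ℝ) * C (1 / 2) = 1 := by
    rw [← map_ofNat C 2, ← C_mul]; norm_num
  rw [C_add]
  linear_combination (-1 : MvPolynomial τ ℝ) * e1 + a * e2

end QModArch

theorem eval_smul_homog {τ : Type*} {p : MvPolynomial τ ℝ} {d : ℕ} (hp : p.IsHomogeneous d)
    (t : ℝ) (x : τ → ℝ) : eval (t • x) p = t ^ d * eval x p := by
  rw [eval_eq, eval_eq, Finset.mul_sum]
  refine Finset.sum_congr rfl fun α hα => ?_
  have h1 := hp (mem_support_iff.1 hα)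
  have h2 : ∑ i ∈ α.support, α i = d := by
    rw [← h1]; simp [Finsupp.weight_apply, Finsupp.sum]
  simp only [Pi.smul_apply, smul_eq_mul, mul_pow, Finset.prod_mul_distrib]
  rw [Finset.prod_pow_eq_pow_sum, h2]
  ring

theorem eval_homog {n : ℕ} (f : MvPolynomial (Fin n) ℝ) (y : Fin (n + 1) → ℝ) (hy : y 0 ≠ 0) :
    eval y (homog f) = y 0 ^ f.totalDegree * eval (fun i => y i.succ / y 0) f := by
  rw [homog, map_sum, eval_eq, Finset.mul_sum]
  refine Finset.sum_congr rfl fun α hα => ?_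
  rw [eval_monomial, Finsupp.prod_add_index' (by simp) (by intros; rw [pow_add]),
    Finsupp.prod_mapDomain_index (by simp) (by intros; rw [pow_add]),
    Finsupp.prod_single_index (by simp)]
  have hle : (α.sum fun _ e => e) ≤ f.totalDegree := le_totalDegree hα
  have h3 : y 0 ^ f.totalDegree = y 0 ^ (f.totalDegree - α.sum fun _ e => e) *
      ∏ i ∈ α.support, y 0 ^ α i := by
    rw [Finset.prod_pow_eq_pow_sum, ← pow_add]
    congr 1
    exact (Nat.sub_add_cancel hle).symm
  rw [h3, Finsupp.prod]
  simp only [div_pow, Finset.prod_div_distrib]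
  have h4 : ∏ i ∈ α.support, y 0 ^ α i ≠ 0 := Finset.prod_ne_zero_iff.2 fun i _ => pow_ne_zero _ hy
  field_simp

theorem mem_StO {n : ℕ} {ι : Type*} (g : ι → MvPolynomial (Fin n) ℝ) (y : Fin (n + 1) → ℝ) :
    y ∈ StO g ↔ 0 < y 0 ∧ (fun i : Fin n => y i.succ / y 0) ∈ semiS g := by
  constructor
  · rintro ⟨h1, h2⟩
    refine ⟨h2, fun j => ?_⟩
    have := h1 j
    rw [eval_homog _ _ h2.ne'] at this
    exact nonneg_of_mul_nonneg_right this (by positivity)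
  · rintro ⟨h2, h1⟩
    refine ⟨fun j => ?_, h2⟩
    rw [eval_homog _ _ h2.ne']
    have := h1 j
    positivity

theorem smul_mem_StO {n : ℕ} {ι : Type*} (g : ι → MvPolynomial (Fin n) ℝ) {y : Fin (n + 1) → ℝ}
    (hy : y ∈ StO g) {t : ℝ} (ht : 0 < t) : t • y ∈ StO g := by
  rw [mem_StO] at *
  refine ⟨by simpa using mul_pos ht hy.1, ?_⟩
  convert hy.2 using 2 with i
  simp only [Pi.smul_apply, smul_eq_mul]
  rw [mul_div_mul_left _ _ ht.ne']

theorem smul_mem_cone {n : ℕ} {ι : Type*} (g : ι → MvPolynomial (Fin n) ℝ)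
    {t : ℝ} (ht : 0 < t) {y : Fin (n + 1) → ℝ} (hy : y ∈ convexHull ℝ (closure (StO g))) :
    t • y ∈ convexHull ℝ (closure (StO g)) := by
  have hc : Convex ℝ {y : Fin (n + 1) → ℝ | t • y ∈ convexHull ℝ (closure (StO g))} := by
    have := (convex_convexHull ℝ (closure (StO g))).is_linear_preimage
      (IsLinearMap.isLinearMap_smul (R := ℝ) (M := Fin (n + 1) → ℝ) t)
    exact this
  refine convexHull_min ?_ hc hy
  intro z hz
  apply subset_convexHull
  exact map_mem_closure (f := fun z => t • z) (by fun_prop) hz fun w hw => smul_mem_StO g hw ht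

/-- Points of the cone at height one lie in the closed convex hull of `S`. -/
theorem mem_of_cone {n : ℕ} {ι : Type*} (g : ι → MvPolynomial (Fin n) ℝ) (x : Fin n → ℝ)
    (hx : (Fin.cons 1 x : Fin (n + 1) → ℝ) ∈ convexHull ℝ (closure (StO g))) :
    x ∈ closure (convexHull ℝ (semiS g)) := by
  let π : (Fin (n + 1) → ℝ) → (Fin n → ℝ) := fun y i => y i.succ / y 0
  let D : Set (Fin (n + 1) → ℝ) := {y | 0 < y 0 ∧ π y ∈ convexHull ℝ (semiS g)}
  have hD : Convex ℝ D := by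
    rintro y ⟨hy0, hy⟩ z ⟨hz0, hz⟩ s t hs ht hst
    have hpos : 0 < s * y 0 + t * z 0 := by
      rcases hs.eq_or_lt with rfl | hs
      · have : t = 1 := by linarith
        simpa [this] using hz0
      · have := mul_pos hs hy0
        have := mul_nonneg ht hz0.le
        linarith
    refine ⟨by simpa using hpos, ?_⟩
    have := convex_convexHull ℝ (semiS g) hy hz (a := s * y 0 / (s * y 0 + t * z 0))
      (b := t * z 0 / (s * y 0 + t * z 0)) (by positivity) (by positivity) (by field_simp)
    convert this using 1
    ext i
    simp only [π, Pi.add_apply, Pi.smul_apply, smul_eq_mul]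
    field_simp
  have h1 : convexHull ℝ (closure (StO g)) ⊆ closure D := by
    refine convexHull_min (closure_mono fun y hy => ?_) hD.closure
    rw [mem_StO] at hy
    exact ⟨hy.1, subset_convexHull _ _ hy.2⟩
  have h2 := h1 hx
  have hcont : ContinuousAt π (Fin.cons 1 x) := by
    refine continuousAt_pi.2 fun i => ContinuousAt.div
      (continuous_apply _).continuousAt (continuous_apply _).continuousAt (by simp)
  have h3 : π (Fin.cons 1 x) = x := by ext i; simp [π]
  rw [← h3]
  exact hcont.continuousWithinAt.mem_closure h2 fun y hy => hy.2

theorem tGens_one_sub {n : ℕ} {ι : Type*} [Fintype ι] (g : ι → MvPolynomial (Fin n) ℝ)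
    (i : Fin (n + 1)) : 1 - X i * X i ∈ QFull (tGens g) := by
  have h1 := QFull_gen (tGens g) (Sum.inr 2)
  have e : tGens g (Sum.inr 2) = 1 - ∑ i, X i ^ 2 := by simp [tGens]
  rw [e] at h1
  have h2 := QFull_add _ h1 (QFull_sumSq (tGens g)
    (IsSumSq.sum_sq (Finset.univ.erase i) (fun j => (X j : MvPolynomial (Fin (n + 1)) ℝ))))
  convert h2 using 1
  rw [← Finset.add_sum_erase _ _ (Finset.mem_univ i)]
  ring

/-- Putinar theorem for the homogenized generators. -/
theorem putinar_tGens {n : ℕ} {ι : Type*} [Fintype ι] (g : ι → MvPolynomial (Fin n) ℝ)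
    (f : MvPolynomial (Fin (n + 1)) ℝ) (δ : ℝ) (hδ : 0 < δ)
    (hf : ∀ z ∈ StS g, δ ≤ eval z f) : ∃ k, f ∈ QMod (k + 1) (tGens g) := by
  refine QFull_QMod _ ((QFull_arch _ (tGens_one_sub g)).putinar f δ hδ fun φ hφ => ?_)
  let z : Fin (n + 1) → ℝ := fun i => φ (X i)
  have hz : ∀ p, φ p = eval z p := by
    intro p
    have : φ = aeval z := by
      apply MvPolynomial.algHom_ext
      intro i; simp [z]
    rw [this, aeval_eq_eval]
  have hgen : ∀ i, 0 ≤ eval z (tGens g i) := fun i => by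
    rw [← hz]; exact hφ _ (QFull_gen _ i)
  rw [hz]
  refine hf z ⟨fun j => by simpa [tGens] using hgen (Sum.inl j),
    by simpa [tGens] using hgen (Sum.inr 0), ?_⟩
  have a1 := hgen (Sum.inr 1)
  have a2 := hgen (Sum.inr 2)
  simp [tGens] at a1 a2
  exact le_antisymm a2 a1

theorem cone_sep {E : Type*} [TopologicalSpace E] [AddCommGroup E] [Module ℝ E]
    [IsTopologicalAddGroup E] [ContinuousSMul ℝ E] [LocallyConvexSpace ℝ E] {K : Set E}
    (hK : Convex ℝ K) (hcl : IsClosed K) (h0 : (0 : E) ∈ K)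
    (hs : ∀ t : ℝ, 0 < t → ∀ y ∈ K, t • y ∈ K) {x : E} (hx : x ∉ K) :
    ∃ l : StrongDual ℝ E, (∀ y ∈ K, 0 ≤ l y) ∧ l x < 0 := by
  obtain ⟨l, u, h1, h2⟩ := geometric_hahn_banach_point_closed hK hcl hx
  have hu : u < 0 := by simpa using h2 0 h0
  refine ⟨l, fun y hy => ?_, h1.trans hu⟩
  by_contra hneg
  push Not at hneg
  have h3 := h2 _ (hs (u / l y) (div_pos_of_neg_of_neg hu hneg) y hy)
  rw [map_smul, smul_eq_mul, div_mul_cancel₀ _ hneg.ne] at h3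
  exact lt_irrefl _ h3

theorem isCompact_StS {n : ℕ} {ι : Type*} (g : ι → MvPolynomial (Fin n) ℝ) :
    IsCompact (StS g) := by
  have hcl : IsClosed (StS g) := by
    have e : StS g = (⋂ j, {x | 0 ≤ eval x (homog (g j))}) ∩
        ({x | 0 ≤ x 0} ∩ {x | ∑ i, x i ^ 2 = 1}) := by
      ext x; simp [StS]
    rw [e]
    refine IsClosed.inter (isClosed_iInter fun j => isClosed_le continuous_const ?_)
      (IsClosed.inter (isClosed_le continuous_const (continuous_apply 0))
      (isClosed_eq (by fun_prop) continuous_const))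
    exact MvPolynomial.continuous_eval _
  refine IsCompact.of_isClosed_subset (isCompact_univ_pi fun a => isCompact_Icc (a := (-1 : ℝ))
    (b := 1)) hcl ?_
  rintro x ⟨-, -, hx⟩ i -
  have := Finset.single_le_sum (f := fun i => x i ^ 2) (fun _ _ => sq_nonneg _)
    (Finset.mem_univ i)
  rw [hx] at this
  exact abs_le.1 ((sq_le_one_iff_abs_le_one _).1 this)

/-- The linear form of a functional as a polynomial. -/
noncomputable def linPoly {n : ℕ} (l : StrongDual ℝ (Fin n → ℝ)) : MvPolynomial (Fin n) ℝ :=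
  ∑ i, C (l (Pi.single i 1)) * X i

theorem linPoly_hom {n : ℕ} (l : StrongDual ℝ (Fin n → ℝ)) : (linPoly l).IsHomogeneous 1 :=
  IsHomogeneous.sum _ _ _ fun _ _ => isHomogeneous_C_mul_X _ _

theorem linPoly_eval {n : ℕ} (l : StrongDual ℝ (Fin n → ℝ)) (y : Fin n → ℝ) :
    eval y (linPoly l) = l y := by
  have e : y = ∑ i, y i • (Pi.single i (1 : ℝ) : Fin n → ℝ) := by
    ext j
    simp [Finset.sum_apply, Pi.single_apply]
  conv_rhs => rw [e, map_sum]
  simp [linPoly, mul_comm]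

theorem thetaB_sup {n : ℕ} {ι : Type*} [Fintype ι] (g : ι → MvPolynomial (Fin n) ℝ) (k : ℕ) :
    closure (convexHull ℝ (semiS g)) ⊆ thetaB k g := by
  have e : thetaB k g = ⋂ l ∈ {l | l ∈ QMod k (tGens g) ∧ l.IsHomogeneous 1},
      {x : Fin n → ℝ | 0 ≤ eval (Fin.cons 1 x) l} := by
    ext x; simp [thetaB]
  have hlin : ∀ l : MvPolynomial (Fin (n + 1)) ℝ, l.IsHomogeneous 1 → ∀ y z : Fin (n + 1) → ℝ,
      eval (y + z) l = eval y l + eval z l := by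
    intro l hl y z
    rw [eval_eq, eval_eq, eval_eq, ← Finset.sum_add_distrib]
    refine Finset.sum_congr rfl fun α hα => ?_
    have h1 := hl (mem_support_iff.1 hα)
    obtain ⟨i, rfl⟩ : ∃ i, α = Finsupp.single i 1 := by
      have h2 : (α.sum fun _ e => e) = 1 := by
        simpa [Finsupp.weight_apply] using h1
      exact (Finsupp.sum_eq_one_iff α).1 h2
    simp [Finsupp.support_single, mul_add]
  refine closure_minimal (convexHull_min ?_ ?_) ?_
  · intro x hx l hl hom
    set y : Fin (n + 1) → ℝ := Fin.cons 1 x with hy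
    have hyO : y ∈ StO g := by
      rw [mem_StO]
      simpa [hy] using hx
    have hpos : 0 < ∑ i, y i ^ 2 := by
      rw [Fin.sum_univ_succ]
      have h1 : y 0 = 1 := by simp [hy]
      have : 0 ≤ ∑ i : Fin n, y i.succ ^ 2 := Finset.sum_nonneg fun _ _ => sq_nonneg _
      rw [h1]; linarith
    set r := Real.sqrt (∑ i, y i ^ 2) with hr
    have hr0 : 0 < r := Real.sqrt_pos.2 hpos
    have hr2 : r ^ 2 = ∑ i, y i ^ 2 := Real.sq_sqrt hpos.le
    have hz := smul_mem_StO g hyO (inv_pos.2 hr0)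
    have hs : ∑ i, (r⁻¹ • y) i ^ 2 = 1 := by
      simp only [Pi.smul_apply, smul_eq_mul, mul_pow]
      rw [← Finset.mul_sum, ← hr2, inv_pow, inv_mul_cancel₀ (by positivity)]
    have h1 := QMod_eval_nonneg _ hl (r⁻¹ • y) (by
      rintro (j | j)
      · exact hz.1 j
      · fin_cases j
        · simpa [tGens] using hz.2.le
        · have : eval (r⁻¹ • y) (∑ i, X i ^ 2 - 1 : MvPolynomial (Fin (n + 1)) ℝ) = 0 := by
            simp only [map_sub, map_sum, map_pow, eval_X, map_one, hs, sub_self]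
          exact this.ge
        · have : eval (r⁻¹ • y) (1 - ∑ i, X i ^ 2 : MvPolynomial (Fin (n + 1)) ℝ) = 0 := by
            simp only [map_sub, map_sum, map_pow, eval_X, map_one, hs, sub_self]
          exact this.ge)
    rw [eval_smul_homog hom, pow_one] at h1
    exact nonneg_of_mul_nonneg_right h1 (inv_pos.2 hr0)
  · intro x hx y hy s t hs ht hst l hl hom
    have e2 : (Fin.cons 1 (s • x + t • y) : Fin (n + 1) → ℝ) =
        s • (Fin.cons 1 x : Fin (n + 1) → ℝ) + t • (Fin.cons 1 y : Fin (n + 1) → ℝ) := by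
      ext i
      refine Fin.cases ?_ (fun i => ?_) i
      · simp [hst]
      · simp
    rw [e2, hlin l hom, eval_smul_homog hom, eval_smul_homog hom, pow_one, pow_one]
    exact add_nonneg (mul_nonneg hs (hx l hl hom)) (mul_nonneg ht (hy l hl hom))
  · rw [e]
    refine isClosed_biInter fun l _ => isClosed_le continuous_const ?_
    refine (MvPolynomial.continuous_eval l).comp (continuous_pi fun i => ?_)
    refine Fin.cases ?_ (fun i => ?_) i
    · simpa using continuous_const
    · simpa using continuous_apply i

theorem thetaB_sub {n : ℕ} {ι : Type*} [Fintype ι] (g : ι → MvPolynomial (Fin n) ℝ)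
    (hA : AssumpA g) (x : Fin n → ℝ) (hx : x ∉ closure (convexHull ℝ (semiS g))) :
    ∃ k, x ∉ thetaB (k + 1) g := by
  obtain ⟨hcl, hKc, hpt⟩ := hA
  set K := convexHull ℝ (closure (StO g)) with hKdef
  have h0 : (0 : Fin (n + 1) → ℝ) ∈ K ∩ -K := by rw [hpt]; rfl
  have hsub : StS g ⊆ K := by
    rintro y ⟨h1, h2, -⟩
    apply subset_convexHull
    rw [hcl]; exact ⟨h1, h2⟩
  have hconv : Convex ℝ K := convex_convexHull _ _
  have hs : ∀ t : ℝ, 0 < t → ∀ y ∈ K, t • y ∈ K := fun t ht y hy => smul_mem_cone g ht hy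
  obtain ⟨l, hl, hlx⟩ := cone_sep hconv hKc h0.1 hs
    (x := (Fin.cons 1 x : Fin (n + 1) → ℝ)) fun h => hx (mem_of_cone g x h)
  obtain ⟨l', hl', hl'S⟩ : ∃ l' : StrongDual ℝ (Fin (n + 1) → ℝ), (∀ y ∈ K, 0 ≤ l' y) ∧
      ∀ y ∈ StS g, 0 < l' y := by
    refine (isCompact_StS g).induction_on
      (p := fun s => ∃ l' : StrongDual ℝ (Fin (n + 1) → ℝ), (∀ y ∈ K, 0 ≤ l' y) ∧
        ∀ y ∈ s ∩ StS g, 0 < l' y) ?_ ?_ ?_ ?_ |>.imp fun l' h => ⟨h.1, fun y hy => h.2 y ⟨hy, hy⟩⟩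
    · exact ⟨0, by simp, by simp⟩
    · rintro s t hst ⟨l', h1, h2⟩
      exact ⟨l', h1, fun y hy => h2 y ⟨hst hy.1, hy.2⟩⟩
    · rintro s t ⟨l₁, a1, a2⟩ ⟨l₂, b1, b2⟩
      refine ⟨l₁ + l₂, fun y hy => add_nonneg (a1 y hy) (b1 y hy), ?_⟩
      rintro y ⟨hy | hy, hyS⟩
      · exact add_pos_of_pos_of_nonneg (a2 y ⟨hy, hyS⟩) (b1 y (hsub hyS))
      · exact add_pos_of_nonneg_of_pos (a1 y (hsub hyS)) (b2 y ⟨hy, hyS⟩)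
    · intro y hy
      have hyK : -y ∉ K := by
        intro hneg
        have : y ∈ K ∩ -K := ⟨hsub hy, hneg⟩
        rw [hpt] at this
        have hy1 := hy.2.2
        rw [Set.mem_singleton_iff.1 this] at hy1
        simp at hy1
      obtain ⟨l₁, a1, a2⟩ := cone_sep hconv hKc h0.1 hs hyK
      rw [map_neg] at a2
      refine ⟨{z | 0 < l₁ z}, mem_nhdsWithin_of_mem_nhds ?_, l₁, a1, fun z hz => hz.1⟩
      exact (isOpen_lt continuous_const l₁.continuous).mem_nhds (by simpa using a2)
  obtain ⟨ε, hε, hεx⟩ : ∃ ε : ℝ, 0 < ε ∧ (l + ε • l') (Fin.cons 1 x) < 0 := by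
    set c := l' (Fin.cons 1 x)
    set d := l (Fin.cons 1 x) with hd
    refine ⟨-d / (2 * (|c| + 1)), div_pos (by linarith) (by positivity), ?_⟩
    change d + -d / (2 * (|c| + 1)) * c < 0
    have hc : c ≤ |c| := le_abs_self c
    have h1 : -d / (2 * (|c| + 1)) * c ≤ -d / (2 * (|c| + 1)) * (|c| + 1) :=
      mul_le_mul_of_nonneg_left (by linarith) (div_nonneg (by linarith) (by positivity))
    have h2 : -d / (2 * (|c| + 1)) * (|c| + 1) = -d / 2 := by
      have : |c| + 1 ≠ 0 := by positivity
      field_simp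
    linarith
  have hpos : ∀ y ∈ StS g, 0 < (l + ε • l') y := fun y hy =>
    add_pos_of_nonneg_of_pos (hl y (hsub hy)) (mul_pos hε (hl'S y hy))
  obtain ⟨δ, hδ, hδS⟩ : ∃ δ : ℝ, 0 < δ ∧ ∀ y ∈ StS g, δ ≤ (l + ε • l') y := by
    rcases (StS g).eq_empty_or_nonempty with he | hne
    · exact ⟨1, one_pos, by simp [he]⟩
    · obtain ⟨y, hy, hmin⟩ := (isCompact_StS g).exists_isMinOn hne
        (l + ε • l').continuous.continuousOn
      exact ⟨_, hpos y hy, fun z hz => hmin hz⟩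
  obtain ⟨k, hk⟩ := putinar_tGens g (linPoly (l + ε • l')) δ hδ fun z hz => by
    rw [linPoly_eval]; exact hδS z hz
  refine ⟨k, fun hmem => ?_⟩
  have := hmem _ hk (linPoly_hom _)
  rw [linPoly_eval] at this
  exact absurd hεx (not_lt.2 this)

/-- Theorem 3.6: under Assumption A, `closure (conv S) ⊆ TH̃_k(G̃)` for every `k`, and
`closure (conv S) = ⋂_{k=1}^∞ TH̃_k(G̃)`. -/
theorem stmt6 (n m : ℕ) (g : Fin m → MvPolynomial (Fin n) ℝ) (hA : AssumpA g) :
    (∀ k : ℕ, closure (convexHull ℝ (semiS g)) ⊆ thetaB k g) ∧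
      closure (convexHull ℝ (semiS g)) = ⋂ k : ℕ, thetaB (k + 1) g := by
  refine ⟨fun k => thetaB_sup g k, Set.Subset.antisymm ?_ ?_⟩
  · exact Set.subset_iInter fun k => thetaB_sup g (k + 1)
  · intro x hx
    by_contra hn
    obtain ⟨k, hk⟩ := thetaB_sub g hA x hn
    exact hk (Set.mem_iInter.1 hx k)
end

section
/- Let S = {x ∈ ℝⁿ : g₁(x) ≥ 0, …, g_m(x) ≥ 0}. Suppose Assumption A holds and the PP-BDR property holds for S̃ (with generating set G̃) with order k′. Then closure(conv(S)) = TH̃_{k′}(G̃). -/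
open MvPolynomial Pointwise

open Filter Topology

lemma sumSq_eval_nonneg {τ : Type*} {p : MvPolynomial τ ℝ} (hp : IsSumSq p) (x : τ → ℝ) :
    0 ≤ eval x p := by
  induction hp with
  | zero => simp
  | sq_add a _ ih =>
    rw [map_add, map_mul]
    exact add_nonneg (mul_self_nonneg _) ih

lemma homog_isHomogeneous {n : ℕ} (f : MvPolynomial (Fin n) ℝ) :
    (homog f).IsHomogeneous f.totalDegree := by
  unfold homog
  apply MvPolynomial.IsHomogeneous.sum
  intro α hα
  apply isHomogeneous_monomial
  have h := le_totalDegree hα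
  rw [map_add, Finsupp.degree_single]
  have h2 : (Finsupp.mapDomain Fin.succ α).degree = α.sum fun _ e => e := by
    simp only [Finsupp.degree_eq_sum, Fin.sum_univ_succ]
    rw [Finsupp.mapDomain_of_notMem_range]
    · simp [Finsupp.mapDomain_apply (Fin.succ_injective n), Finsupp.sum_fintype]
    · simp
  omega

lemma homogeneous_eval_smul {σ : Type*} {p : MvPolynomial σ ℝ} {d : ℕ} (hp : p.IsHomogeneous d)
    (t : ℝ) (x : σ → ℝ) : eval (t • x) p = t ^ d * eval x p := by
  rw [eval_eq, eval_eq, Finset.mul_sum]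
  apply Finset.sum_congr rfl
  intro α hα
  have h : α.degree = d := by
    by_contra h
    exact (mem_support_iff.1 hα) (hp.coeff_eq_zero h)
  have : ∏ i ∈ α.support, (t • x) i ^ α i = t ^ d * ∏ i ∈ α.support, x i ^ α i := by
    simp only [Pi.smul_apply, smul_eq_mul, mul_pow, Finset.prod_mul_distrib]
    rw [Finset.prod_pow_eq_pow_sum, ← h, Finsupp.degree_apply]
  rw [this]; ring

lemma homog_eval_cons {n : ℕ} (f : MvPolynomial (Fin n) ℝ) (x : Fin n → ℝ) :
    eval (Fin.cons 1 x : Fin (n+1) → ℝ) (homog f) = eval x f := by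
  unfold homog
  rw [map_sum, eval_eq']
  apply Finset.sum_congr rfl
  intro α hα
  rw [eval_monomial]
  congr 1
  rw [Finsupp.prod_fintype _ _ (by simp), Fin.prod_univ_succ]
  simp [Finsupp.mapDomain_apply (Fin.succ_injective n)]

lemma cons_smul_eq {n : ℕ} (y : Fin (n+1) → ℝ) (h : 0 < y 0) :
    y = y 0 • (Fin.cons 1 (fun i => (y 0)⁻¹ * y i.succ) : Fin (n+1) → ℝ) := by
  ext i
  refine Fin.cases ?_ (fun i => ?_) i
  · simp
  · simp [h.ne']

lemma StC_smul {n : ℕ} {ι : Type*} {g : ι → MvPolynomial (Fin n) ℝ} {y : Fin (n+1) → ℝ}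
    (hy : y ∈ StC g) {t : ℝ} (ht : 0 ≤ t) : t • y ∈ StC g := by
  refine ⟨fun j => ?_, ?_⟩
  · rw [homogeneous_eval_smul (homog_isHomogeneous _)]
    exact mul_nonneg (pow_nonneg ht _) (hy.1 j)
  · exact mul_nonneg ht hy.2

lemma qmod_nonneg {n m : ℕ} {g : Fin m → MvPolynomial (Fin n) ℝ} {k : ℕ}
    {l : MvPolynomial (Fin (n+1)) ℝ} (hl : l ∈ QMod k (tGens g)) {y : Fin (n+1) → ℝ}
    (hy : y ∈ StS g) : 0 ≤ eval y l := by
  obtain ⟨s₀, s, h0, -, hs, rfl⟩ := hl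
  rw [map_add, map_sum]
  refine add_nonneg (sumSq_eval_nonneg h0 y) (Finset.sum_nonneg fun i _ => ?_)
  rw [map_mul]
  refine mul_nonneg (sumSq_eval_nonneg (hs i).1 y) ?_
  obtain ⟨h1, h2, h3⟩ := hy
  rcases i with j | j
  · exact h1 j
  · fin_cases j
    · simpa [tGens] using h2
    · simp [tGens, h3]
    · simp [tGens, h3]

lemma StS_compact {n m : ℕ} (g : Fin m → MvPolynomial (Fin n) ℝ) : IsCompact (StS g) := by
  apply Metric.isCompact_of_isClosed_isBounded
  · have : StS g = (⋂ j, {x | 0 ≤ eval x (homog (g j))}) ∩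
        ({x | 0 ≤ x 0} ∩ {x | ∑ i, x i ^ 2 = 1}) := by
      ext x; simp [StS]
    rw [this]
    refine (isClosed_iInter fun j => isClosed_le continuous_const ?_).inter
      ((isClosed_le continuous_const (continuous_apply 0)).inter
        (isClosed_eq (by fun_prop) continuous_const))
    exact MvPolynomial.continuous_eval _
  · refine (Metric.isBounded_closedBall (x := (0 : Fin (n+1) → ℝ)) (r := 1)).subset ?_
    rintro x ⟨-, -, h⟩
    rw [mem_closedBall_zero_iff, pi_norm_le_iff_of_nonneg zero_le_one]
    intro i
    rw [Real.norm_eq_abs, ← sq_le_one_iff_abs_le_one, ← h]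
    exact Finset.single_le_sum (f := fun i => x i ^ 2) (fun _ _ => sq_nonneg _) (Finset.mem_univ i)

lemma exists_pos_functional {n m : ℕ} (g : Fin m → MvPolynomial (Fin n) ℝ) (hA : AssumpA g) :
    ∃ f : StrongDual ℝ (Fin (n+1) → ℝ), ∀ y ∈ StS g, 0 < f y := by
  obtain ⟨h1, h2, h3⟩ := hA
  rw [h1] at h2 h3
  set K := convexHull ℝ (StC g) with hK
  have hsub : StC g ⊆ K := subset_convexHull _ _
  have hz : (0 : Fin (n+1) → ℝ) ∈ K := by
    have : (0 : Fin (n+1) → ℝ) ∈ K ∩ -K := by rw [h3]; rfl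
    exact this.1
  have hcone : ∀ t : ℝ, 0 ≤ t → ∀ y ∈ K, t • y ∈ K := by
    intro t ht y hy
    have h : t • y ∈ t • K := Set.smul_mem_smul_set hy
    rw [hK, ← convexHull_smul] at h
    refine convexHull_mono ?_ h
    rintro _ ⟨z, hz, rfl⟩
    exact StC_smul hz ht
  have key : ∀ s ∈ StS g, ∃ f : StrongDual ℝ (Fin (n+1) → ℝ), (∀ y ∈ K, 0 ≤ f y) ∧ 0 < f s := by
    intro s hs
    have hsK : s ∈ K := hsub ⟨hs.1, hs.2.1⟩
    have hn : -s ∉ K := by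
      intro h
      have : s ∈ K ∩ -K := ⟨hsK, h⟩
      rw [h3] at this
      have h0 : s = 0 := this
      have := hs.2.2
      simp [h0] at this
    obtain ⟨f, u, hu, hb⟩ := geometric_hahn_banach_point_closed (convex_convexHull ℝ _) h2 hn
    have hu0 : u < 0 := by simpa using hb 0 hz
    refine ⟨f, fun y hy => ?_, ?_⟩
    · by_contra! hneg
      have := hb _ (hcone (u / f y) (div_nonneg_of_nonpos hu0.le hneg.le) y hy)
      rw [map_smul, smul_eq_mul, div_mul_cancel₀ _ hneg.ne] at this
      exact lt_irrefl _ this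
    · rw [map_neg] at hu; linarith
  have := (StS_compact g).induction_on (p := fun A => ∃ f : StrongDual ℝ (Fin (n+1) → ℝ),
    (∀ y ∈ K, 0 ≤ f y) ∧ ∀ s ∈ A, s ∈ StS g → 0 < f s) ⟨0, by simp, by simp⟩
    (fun s t hst ⟨f, hf, hf'⟩ => ⟨f, hf, fun x hx => hf' x (hst hx)⟩)
    (by
      rintro s t ⟨f, hf, hf'⟩ ⟨f2, hf2, hf2'⟩
      refine ⟨f + f2, fun y hy => add_nonneg (hf y hy) (hf2 y hy), ?_⟩
      rintro x (hx | hx) hxS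
      · exact add_pos_of_pos_of_nonneg (hf' x hx hxS) (hf2 x (hsub ⟨hxS.1, hxS.2.1⟩))
      · exact add_pos_of_nonneg_of_pos (hf x (hsub ⟨hxS.1, hxS.2.1⟩)) (hf2' x hx hxS))
    (by
      intro x hx
      obtain ⟨f, hf, hfx⟩ := key x hx
      refine ⟨{y | 0 < f y}, mem_nhdsWithin_of_mem_nhds ?_, f, hf, fun s hs _ => hs⟩
      exact (isOpen_lt continuous_const f.continuous).mem_nhds hfx)
  obtain ⟨f, -, hf⟩ := this
  exact ⟨f, fun y hy => hf y hy hy⟩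

lemma dual_apply {N : ℕ} (f : StrongDual ℝ (Fin N → ℝ)) (y : Fin N → ℝ) :
    f y = ∑ i, f (Pi.single i 1) * y i := by
  have := LinearMap.pi_apply_eq_sum_univ f.toLinearMap y
  simp only [ContinuousLinearMap.coe_coe, smul_eq_mul] at this
  rw [this]
  refine Finset.sum_congr rfl fun i _ => ?_
  rw [mul_comm]
  congr 2
  ext j
  simp [Pi.single_apply, eq_comm]

/-- perturbation step -/
lemma perturb {n m : ℕ} (g : Fin m → MvPolynomial (Fin n) ℝ) (k : ℕ) (hPP : ppBDR k g (StS g))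
    (a : Fin (n+1) → ℝ) (z : Fin (n+1) → ℝ) (ha : ∀ y ∈ StS g, 0 < ∑ i, a i * y i)
    (hz : ∑ i, a i * z i < 0) :
    ∃ l ∈ QMod k (tGens g), l.IsHomogeneous 1 ∧ eval z l < 0 := by
  set c₀ : Fin (n+2) → ℝ := Fin.cons 0 a with hc₀
  have e1 : ∀ᶠ c in 𝓝 c₀, ∀ y ∈ StS g, 0 < c 0 + ∑ i : Fin (n + 1), c i.succ * y i := by
    apply (StS_compact g).eventually_forall_of_forall_eventually
      (P := fun (c : Fin (n+2) → ℝ) y => 0 < c 0 + ∑ i : Fin (n + 1), c i.succ * y i)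
    intro y hy
    have hc : Continuous fun q : (Fin (n+2) → ℝ) × (Fin (n+1) → ℝ) =>
      q.1 0 + ∑ i : Fin (n + 1), q.1 i.succ * q.2 i := by fun_prop
    refine hc.continuousAt.eventually_const_lt ?_
    simpa [hc₀] using ha y hy
  have e2 : ∀ᶠ c in 𝓝 c₀, ∑ i : Fin (n + 1), c i.succ * z i < 0 := by
    have hc : Continuous fun q : (Fin (n+2) → ℝ) =>
      ∑ i : Fin (n + 1), q i.succ * z i := by fun_prop
    refine hc.continuousAt.eventually_lt_const ?_
    simpa [hc₀] using hz
  obtain ⟨U, hU, hUo, hcU⟩ := eventually_nhds_iff.1 (e1.and e2)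
  have hVo : IsOpen (U ∩ {c | c 0 < 0}) :=
    hUo.inter (isOpen_lt (continuous_apply 0) continuous_const)
  have hVne : (U ∩ {c : Fin (n+2) → ℝ | c 0 < 0}).Nonempty := by
    have hcont : Continuous fun t : ℝ => (Fin.cons t a : Fin (n+2) → ℝ) := by
      refine continuous_pi fun i => ?_
      refine Fin.cases ?_ (fun i => ?_) i
      · simpa using continuous_id'
      · simpa using continuous_const
    have h0 : ∀ᶠ t : ℝ in 𝓝[<] 0, (Fin.cons t a : Fin (n+2) → ℝ) ∈ U :=
      nhdsWithin_le_nhds (hcont.continuousAt.eventually_mem (hUo.mem_nhds hcU))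
    obtain ⟨t, ht, ht'⟩ := (h0.and self_mem_nhdsWithin).exists
    exact ⟨_, ht, by simpa using ht'⟩
  have hmeas := hVo.measure_pos MeasureTheory.volume hVne
  obtain ⟨c, ⟨hcU', hc0⟩, hcN⟩ : ∃ c ∈ U ∩ {c : Fin (n+2) → ℝ | c 0 < 0},
      (C (c 0) + ∑ i : Fin (n + 1), C (c i.succ) * X i) ∈ QMod k (tGens g) := by
    by_contra! hcon
    refine hmeas.ne' (MeasureTheory.measure_mono_null ?_ hPP)
    intro c hc
    exact ⟨(hU c hc.1).1, hcon c hc⟩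
  have hc0 : c 0 < 0 := hc0
  obtain ⟨s₀, s, h0, hd, hs, he⟩ := hcN
  refine ⟨∑ i : Fin (n + 1), C (c i.succ) * X i, ⟨s₀ + C (-c 0), s, ?_, ?_, hs, ?_⟩, ?_, ?_⟩
  · refine h0.add ?_
    have : (C (-c 0) : MvPolynomial (Fin (n+1)) ℝ) = C √(-c 0) * C √(-c 0) := by
      rw [← C_mul, Real.mul_self_sqrt (by linarith)]
    rw [this]
    exact IsSumSq.mul_self _
  · refine (totalDegree_add _ _).trans (max_le hd ?_)
    simp
  · rw [add_right_comm, ← he, C_neg]; ring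
  · apply MvPolynomial.IsHomogeneous.sum
    intro i _
    simpa using (isHomogeneous_C _ (c i.succ)).mul (isHomogeneous_X ℝ i)
  · simpa using (hU c hcU').2

lemma subset_theta {n m : ℕ} (g : Fin m → MvPolynomial (Fin n) ℝ) (k : ℕ) :
    semiS g ⊆ thetaB k g := by
  intro x hx l hl hh
  set y : Fin (n+1) → ℝ := Fin.cons 1 x with hy
  set N := ∑ i, y i ^ 2 with hN
  have hNpos : 0 < N := by
    rw [hN, Fin.sum_univ_succ]
    have : 0 ≤ ∑ i : Fin n, y i.succ ^ 2 := Finset.sum_nonneg fun _ _ => sq_nonneg _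
    have : y 0 = 1 := rfl
    rw [this]; linarith
  have hr : 0 < (√N)⁻¹ := inv_pos.2 (Real.sqrt_pos.2 hNpos)
  have hyC : y ∈ StC g := ⟨fun j => by rw [hy, homog_eval_cons]; exact hx j, by simp [hy]⟩
  have h1 := StC_smul hyC hr.le
  have h2 : (√N)⁻¹ • y ∈ StS g := by
    refine ⟨h1.1, h1.2, ?_⟩
    simp only [Pi.smul_apply, smul_eq_mul, mul_pow, ← Finset.mul_sum]
    rw [← hN, inv_pow, Real.sq_sqrt hNpos.le, inv_mul_cancel₀ hNpos.ne']
  have h3 := qmod_nonneg hl h2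
  rw [homogeneous_eval_smul hh, pow_one] at h3
  exact nonneg_of_mul_nonneg_right h3 hr

lemma lin_eval {n : ℕ} {l : MvPolynomial (Fin (n+1)) ℝ} (hh : l.IsHomogeneous 1)
    (x y : Fin n → ℝ) (a b : ℝ) (hab : a + b = 1) :
    eval (Fin.cons 1 (a • x + b • y) : Fin (n+1) → ℝ) l =
      a * eval (Fin.cons 1 x : Fin (n+1) → ℝ) l + b * eval (Fin.cons 1 y : Fin (n+1) → ℝ) l := by
  rw [eval_eq, eval_eq, eval_eq, Finset.mul_sum, Finset.mul_sum, ← Finset.sum_add_distrib]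
  refine Finset.sum_congr rfl fun α hα => ?_
  have h : α.degree = 1 := by
    by_contra h
    exact (mem_support_iff.1 hα) (hh.coeff_eq_zero h)
  obtain ⟨i, rfl⟩ := (Finsupp.sum_eq_one_iff α).1 h
  rw [Finsupp.support_single _ one_ne_zero]
  simp only [Finset.prod_singleton, Finsupp.single_eq_same, pow_one]
  refine Fin.cases ?_ (fun i => ?_) i
  · simp only [Fin.cons_zero, mul_one]; rw [← add_mul, hab, one_mul]
  · simp only [Fin.cons_succ, Pi.add_apply, Pi.smul_apply, smul_eq_mul]; ring

lemma theta_convex {n m : ℕ} (g : Fin m → MvPolynomial (Fin n) ℝ) (k : ℕ) :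
    Convex ℝ (thetaB k g) := by
  intro x hx y hy a b ha hb hab l hl hh
  rw [lin_eval hh x y a b hab]
  exact add_nonneg (mul_nonneg ha (hx l hl hh)) (mul_nonneg hb (hy l hl hh))

lemma theta_closed {n m : ℕ} (g : Fin m → MvPolynomial (Fin n) ℝ) (k : ℕ) :
    IsClosed (thetaB k g) := by
  have : thetaB k g = ⋂ l ∈ QMod k (tGens g), ⋂ (_ : l.IsHomogeneous 1),
      {x | 0 ≤ eval (Fin.cons 1 x : Fin (n+1) → ℝ) l} := by
    ext x; simp [thetaB]
  rw [this]
  refine isClosed_biInter fun l _ => isClosed_iInter fun _ => isClosed_le continuous_const ?_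
  refine (MvPolynomial.continuous_eval l).comp (continuous_pi fun i => ?_)
  refine Fin.cases ?_ (fun i => ?_) i
  · simpa using continuous_const
  · simpa using continuous_apply i

/-- Corollary 3.8: under Assumption A, if the PP-BDR property holds for `S̃` (with the
generating set `G̃`) with order `k'`, then `closure (conv S) = TH̃_{k'}(G̃)`. -/
theorem stmt7 (n m : ℕ) (g : Fin m → MvPolynomial (Fin n) ℝ) (hA : AssumpA g)
    (k' : ℕ) (hPP : ppBDR k' g (StS g)) :
    closure (convexHull ℝ (semiS g)) = thetaB k' g := by
  apply Set.Subset.antisymm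
  · exact closure_minimal (convexHull_min (subset_theta g k') (theta_convex g k'))
      (theta_closed g k')
  intro x hx
  by_contra hn
  obtain ⟨f, u, hu, hb⟩ := geometric_hahn_banach_point_closed
    (convex_convexHull ℝ (semiS g)).closure isClosed_closure hn
  obtain ⟨f0, hf0⟩ := exists_pos_functional g hA
  set p : Fin (n+1) → ℝ := Fin.cons (-u) (fun i => f (Pi.single i 1)) with hp
  have hpe : ∀ x : Fin n → ℝ, ∑ i, p i * (Fin.cons 1 x : Fin (n+1) → ℝ) i = f x - u := by
    intro x
    rw [Fin.sum_univ_succ, dual_apply f x]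
    simp [hp]; ring
  have hpO : ∀ y ∈ StO g, 0 ≤ ∑ i, p i * y i := by
    rintro y ⟨hy, hy0⟩
    have hyy := cons_smul_eq y hy0
    set w : Fin n → ℝ := fun i => (y 0)⁻¹ * y i.succ with hw
    have hwS : w ∈ semiS g := by
      intro j
      have := hy j
      rw [hyy, homogeneous_eval_smul (homog_isHomogeneous _), homog_eval_cons] at this
      exact nonneg_of_mul_nonneg_right this (pow_pos hy0 _)
    have h1 := hb w (subset_closure (subset_convexHull ℝ _ hwS))
    have h2 : ∑ i, p i * y i = y 0 * (f w - u) := by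
      rw [← hpe w, Finset.mul_sum]
      refine Finset.sum_congr rfl fun i _ => ?_
      have := congrFun hyy i
      rw [Pi.smul_apply, smul_eq_mul] at this
      rw [this]
      ring
    rw [h2]
    exact mul_nonneg hy0.le (by linarith)
  have hpC : ∀ y ∈ StC g, 0 ≤ ∑ i, p i * y i := by
    intro y hy
    rw [← hA.1] at hy
    have hcl : IsClosed {y : Fin (n+1) → ℝ | 0 ≤ ∑ i, p i * y i} :=
      isClosed_le continuous_const (by fun_prop)
    exact closure_minimal hpO hcl hy
  set z : Fin (n+1) → ℝ := Fin.cons 1 x with hz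
  obtain ⟨ε, hε, hεz⟩ : ∃ ε : ℝ, 0 < ε ∧ f x - u + ε * f0 z < 0 := by
    have hc : Continuous fun ε : ℝ => f x - u + ε * f0 z := by fun_prop
    have h0 : ∀ᶠ t : ℝ in 𝓝[>] 0, f x - u + t * f0 z < 0 :=
      nhdsWithin_le_nhds (hc.continuousAt.eventually_lt_const (by simpa using hu))
    obtain ⟨t, ht, ht'⟩ := (h0.and self_mem_nhdsWithin).exists
    exact ⟨t, ht', ht⟩
  have hsum : ∀ y : Fin (n+1) → ℝ, ∑ i, (p i + ε * f0 (Pi.single i 1)) * y i =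
      ∑ i, p i * y i + ε * f0 y := by
    intro y
    rw [dual_apply f0 y, Finset.mul_sum, ← Finset.sum_add_distrib]
    exact Finset.sum_congr rfl fun i _ => by ring
  obtain ⟨l, hl, hh, hneg⟩ := perturb g k' hPP (fun i => p i + ε * f0 (Pi.single i 1)) z
    (fun y hy => by
      rw [hsum]
      exact add_pos_of_nonneg_of_pos (hpC y ⟨hy.1, hy.2.1⟩) (mul_pos hε (hf0 y hy)))
    (by rw [hsum, hpe]; exact hεz)
  exact absurd (hx l hl hh) (not_le.2 hneg)
end
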